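/- arXiv:1806.00519 — 2 statements merged into one kernel-verified Lean document; each statement's English description precedes it below -/
import Mathlib

section
/- Let x̂ ∈ X be a generalized mode of the Borel probability measure μ and let E be a dense subset of X. Then for every sequence {δ_n} of positive reals with δ_n → 0 there exists a sequence {w̃_n} ⊂ E with w̃_n → x̂ in X such that lim_{n→∞} μ(B^{δ_n}(w̃_n)) / sup_{x ∈ X} μ(B^{δ_n}(x)) = 1. -/
open MeasureTheory Metric Filter Topology

/-- The maximal probability of an open ball of radius `δ` under `μ`. -/
noncomputable def maxBallProb {X : Type*} [PseudoMetricSpace X] [MeasurableSpace X]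
    (μ : Measure X) (δ : ℝ) : ℝ :=
  ⨆ x : X, (μ (ball x δ)).toReal

/-- `xhat` is a strong mode of `μ` if `μ(B^δ(xhat))/M^δ → 1` as `δ → 0⁺`. -/
def IsStrongMode {X : Type*} [PseudoMetricSpace X] [MeasurableSpace X]
    (μ : Measure X) (xhat : X) : Prop :=
  Tendsto (fun δ : ℝ => (μ (ball xhat δ)).toReal / maxBallProb μ δ) (𝓝[>] (0 : ℝ)) (𝓝 1)

/-- `xhat` is a generalized mode of `μ` if for every positive sequence `δ_n → 0` there is an
approximating sequence `w_n → xhat` with `μ(B^{δ_n}(w_n))/M^{δ_n} → 1`. -/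
def IsGeneralizedMode {X : Type*} [PseudoMetricSpace X] [MeasurableSpace X]
    (μ : Measure X) (xhat : X) : Prop :=
  ∀ δ : ℕ → ℝ, (∀ n, 0 < δ n) → Tendsto δ atTop (𝓝 (0 : ℝ)) →
    ∃ w : ℕ → X, Tendsto w atTop (𝓝 xhat) ∧
      Tendsto (fun n => (μ (ball (w n) (δ n))).toReal / maxBallProb μ (δ n)) atTop (𝓝 1)

/-- The mass of an open ball of fixed radius is a lower semicontinuous function of its center. -/
theorem lowerSemicontinuous_measureReal_ball {X : Type*} [PseudoMetricSpace X]
    [MeasurableSpace X] (μ : Measure X) [IsFiniteMeasure μ] (δ : ℝ) :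
    LowerSemicontinuous fun x : X => (μ (ball x δ)).toReal := by
  intro x c hc
  have hU : ⋃ n : ℕ, ball x (δ - 1 / ((n : ℝ) + 1)) = ball x δ := by
    ext y
    simp only [Set.mem_iUnion, mem_ball]
    constructor
    · rintro ⟨n, hn⟩
      have : (0 : ℝ) < 1 / ((n : ℝ) + 1) := Nat.one_div_pos_of_nat
      linarith
    · intro hy
      obtain ⟨n, hn⟩ := exists_nat_one_div_lt (sub_pos.2 hy)
      exact ⟨n, by linarith⟩
  have hmono : Monotone fun n : ℕ => ball x (δ - 1 / ((n : ℝ) + 1)) := fun m n hmn =>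
    ball_subset_ball (sub_le_sub_left (Nat.one_div_le_one_div hmn) δ)
  have hlim := tendsto_measure_iUnion_atTop (μ := μ) hmono
  rw [hU] at hlim
  have hlim' := (ENNReal.tendsto_toReal (measure_ne_top μ (ball x δ))).comp hlim
  obtain ⟨n, hn⟩ := (hlim'.eventually (lt_mem_nhds hc)).exists
  filter_upwards [ball_mem_nhds x (Nat.one_div_pos_of_nat (α := ℝ) (n := n))] with y hy
  refine hn.trans_le (ENNReal.toReal_mono (measure_ne_top μ _) (measure_mono ?_))
  refine ball_subset_ball' ?_
  rw [mem_ball, dist_comm] at hy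
  linarith

theorem measureReal_ball_le_maxBallProb {X : Type*} [PseudoMetricSpace X] [MeasurableSpace X]
    (μ : Measure X) [IsFiniteMeasure μ] (x : X) (δ : ℝ) :
    (μ (ball x δ)).toReal ≤ maxBallProb μ δ := by
  refine le_ciSup (f := fun x : X => (μ (ball x δ)).toReal) ⟨(μ Set.univ).toReal, ?_⟩ x
  rintro _ ⟨y, rfl⟩
  exact ENNReal.toReal_mono (measure_ne_top μ _) (measure_mono (Set.subset_univ _))

theorem maxBallProb_nonneg {X : Type*} [PseudoMetricSpace X] [MeasurableSpace X]
    (μ : Measure X) (δ : ℝ) : 0 ≤ maxBallProb μ δ :=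
  Real.iSup_nonneg fun _ => ENNReal.toReal_nonneg

/-- The normalized mass of an open ball is almost preserved when its center is moved slightly
into a dense set. -/
theorem exists_mem_dense_ball_ratio_gt {X : Type*} [PseudoMetricSpace X] [MeasurableSpace X]
    (μ : Measure X) [IsFiniteMeasure μ] {E : Set X} (hE : Dense E) (x : X) (δ : ℝ)
    {ε : ℝ} (hε : 0 < ε) :
    ∃ v ∈ E, dist v x < ε ∧
      (μ (ball x δ)).toReal / maxBallProb μ δ - ε < (μ (ball v δ)).toReal / maxBallProb μ δ := by
  have hev : ∀ᶠ v in 𝓝 x, (μ (ball x δ)).toReal / maxBallProb μ δ - ε <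
      (μ (ball v δ)).toReal / maxBallProb μ δ := by
    rcases (maxBallProb_nonneg μ δ).eq_or_lt with hM | hM
    · simp [← hM, hε]
    · filter_upwards [lowerSemicontinuous_measureReal_ball μ δ x
        ((μ (ball x δ)).toReal - ε * maxBallProb μ δ) (sub_lt_self _ (mul_pos hε hM))] with v hv
      rw [lt_div_iff₀ hM, sub_mul, div_mul_cancel₀ _ hM.ne']
      exact hv
  obtain ⟨v, hvE, hv, hd⟩ := ((mem_closure_iff_frequently.1 (hE x)).and_eventually
    (hev.and (ball_mem_nhds x hε))).exists
  exact ⟨v, hvE, hd, hv⟩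


theorem generalizedMode_approx_in_dense {X : Type*} [NormedAddCommGroup X] [NormedSpace ℝ X]
    [CompleteSpace X] [TopologicalSpace.SeparableSpace X] [MeasurableSpace X] [BorelSpace X]
    (μ : Measure X) [IsProbabilityMeasure μ] (xhat : X)
    (hgen : IsGeneralizedMode μ xhat) (E : Set X) (hE : Dense E) :
    ∀ δ : ℕ → ℝ, (∀ n, 0 < δ n) → Tendsto δ atTop (𝓝 (0 : ℝ)) →
      ∃ w : ℕ → X, (∀ n, w n ∈ E) ∧ Tendsto w atTop (𝓝 xhat) ∧
        Tendsto (fun n => (μ (ball (w n) (δ n))).toReal / ⨆ x : X, (μ (ball x (δ n))).toReal)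
          atTop (𝓝 1) := by
  intro δ hδ hδ0
  obtain ⟨w, hw, hlim⟩ := hgen δ hδ hδ0
  have hε : Tendsto (fun n : ℕ => 1 / ((n : ℝ) + 1)) atTop (𝓝 0) :=
    tendsto_one_div_add_atTop_nhds_zero_nat
  choose v hvE hd hv using fun n : ℕ =>
    exists_mem_dense_ball_ratio_gt μ hE (w n) (δ n) (Nat.one_div_pos_of_nat (α := ℝ) (n := n))
  have hdist : Tendsto (fun n => dist (w n) (v n)) atTop (𝓝 0) :=
    squeeze_zero (fun _ => dist_nonneg) (fun n => (dist_comm (w n) (v n)).trans_le (hd n).le) hε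
  refine ⟨v, hvE, hw.congr_dist hdist, ?_⟩
  refine tendsto_of_tendsto_of_tendsto_of_le_of_le (by simpa using hlim.sub hε)
    tendsto_const_nhds (fun n => (hv n).le) fun n => ?_
  exact div_le_one_of_le₀ (measureReal_ball_le_maxBallProb μ (v n) (δ n))
    (maxBallProb_nonneg μ (δ n))
end

section
/- A point x ∈ X is a generalized mode of the uniform measure μ_γ if and only if x ∈ E_γ. -/
open MeasureTheory Metric Filter Topology

/-- The space `c₀` of real sequences converging to zero, with the supremum norm,
realized as the zero-at-infinity continuous maps on `ℕ`. -/
abbrev CZero : Type := ZeroAtInftyContinuousMap ℕ ℝ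

/-- The set `E_γ = {x : ∀ k, |x_k| ≤ γ_k}`. -/
def Egamma (γ : ℕ → ℝ) : Set CZero := {x | ∀ k, |x k| ≤ γ k}

/-- The set `E_γ^δ = {x : ∀ k, |x_k| ≤ max (γ_k - δ) 0}`. -/
def EgammaD (γ : ℕ → ℝ) (δ : ℝ) : Set CZero := {x | ∀ k, |x k| ≤ max (γ k - δ) 0}

/-- The law `ν_k` of `γ_k ξ_k` where `ξ_k` is uniform on `[-1,1]`: the uniform distribution
on `[-γ_k, γ_k]` if `γ_k > 0`, and the Dirac measure at `0` if `γ_k = 0`. -/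
noncomputable def nuMeas (γ : ℕ → ℝ) (k : ℕ) : Measure ℝ :=
  if γ k = 0 then Measure.dirac 0
  else (ENNReal.ofReal (2 * γ k))⁻¹ • volume.restrict (Set.Icc (-(γ k)) (γ k))

/-- `μ` is the law on `c₀` of the random series `ξ = Σ γ_k ξ_k e_k` with `ξ_k` i.i.d. uniform
on `[-1,1]` (equivalently, the pushforward under `t ↦ (γ_k t_k)_k` of the countable product of
uniform measures on `[-1,1]`), characterized by its finite-dimensional marginals: the
coordinates are independent with `x_k ∼ ν_k`. -/
def IsUniformSeriesLaw (γ : ℕ → ℝ) {m : MeasurableSpace CZero} (μ : Measure CZero) : Prop :=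
  ∀ (n : ℕ) (A : ℕ → Set ℝ), (∀ k, MeasurableSet (A k)) →
    μ {x : CZero | ∀ k < n, x k ∈ A k} = ∏ k ∈ Finset.range n, nuMeas γ k (A k)

theorem CZero.tendsto_atTop (x : CZero) : Tendsto (fun k => x k) atTop (𝓝 0) := by
  have h := x.zero_at_infty'
  rwa [Filter.cocompact_eq_cofinite, Nat.cofinite_eq_atTop] at h

theorem CZero.dist_le_iff {x y : CZero} {C : ℝ} (hC : 0 ≤ C) :
    dist x y ≤ C ↔ ∀ k, |x k - y k| ≤ C := by
  rw [← ZeroAtInftyContinuousMap.dist_toBCF_eq_dist, BoundedContinuousFunction.dist_le hC]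
  rfl

theorem CZero.abs_sub_le_dist (x y : CZero) (k : ℕ) : |x k - y k| ≤ dist x y :=
  (CZero.dist_le_iff dist_nonneg).1 le_rfl k

theorem CZero.measurable_apply [MeasurableSpace CZero] [BorelSpace CZero] (k : ℕ) :
    Measurable (fun x : CZero => x k) := by
  have : LipschitzWith 1 (fun x : CZero => x k) :=
    LipschitzWith.of_dist_le_mul fun x y => by
      simpa [Real.dist_eq] using CZero.abs_sub_le_dist x y k
  exact this.continuous.measurable

theorem CZero.dist_lt_iff {x y : CZero} {δ : ℝ} (hδ : 0 < δ) :
    dist x y < δ ↔ ∀ k, |x k - y k| < δ := by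
  refine ⟨fun h k => (CZero.abs_sub_le_dist x y k).trans_lt h, fun h => ?_⟩
  have finite_bound : ∀ N : ℕ, ∃ C, 0 ≤ C ∧ C < δ ∧ ∀ k < N, |x k - y k| ≤ C := by
    intro N
    induction N with
    | zero => exact ⟨0, le_rfl, hδ, by simp⟩
    | succ N ih =>
      obtain ⟨C, hC0, hC, hCN⟩ := ih
      refine ⟨max C |x N - y N|, le_max_of_le_left hC0, max_lt hC (h N), fun k hk => ?_⟩
      rcases Nat.lt_succ_iff_lt_or_eq.1 hk with hk | rfl
      · exact (hCN k hk).trans (le_max_left _ _)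
      · exact le_max_right _ _
  have hlim : Tendsto (fun k => |x k - y k|) atTop (𝓝 0) := by
    simpa using (x.tendsto_atTop.sub y.tendsto_atTop).abs
  obtain ⟨N, hN⟩ := eventually_atTop.1 (hlim.eventually (gt_mem_nhds (half_pos hδ)))
  obtain ⟨C, hC0, hC, hCN⟩ := finite_bound N
  refine ((CZero.dist_le_iff (C := max C (δ / 2)) (le_max_of_le_left hC0)).2 fun k => ?_).trans_lt
    (max_lt hC (half_lt_self hδ))
  rcases lt_or_ge k N with hk | hk
  · exact (hCN k hk).trans (le_max_left _ _)
  · exact (hN k hk).le.trans (le_max_right _ _)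

theorem CZero.ball_eq_iInter (y : CZero) {δ : ℝ} (hδ : 0 < δ) :
    ball y δ = ⋂ n : ℕ, {x : CZero | ∀ k < n, x k ∈ Set.Ioo (y k - δ) (y k + δ)} := by
  ext x
  simp only [mem_ball, CZero.dist_lt_iff hδ, Set.mem_iInter, Set.mem_ofPred_eq, Set.mem_Ioo,
    abs_sub_lt_iff]
  exact ⟨fun h n k _ => ⟨by linarith [(h k).2], by linarith [(h k).1]⟩,
    fun h k => ⟨by linarith [(h (k + 1) k k.lt_succ_self).2],
      by linarith [(h (k + 1) k k.lt_succ_self).1]⟩⟩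

/-- Coordinatewise projection of `x` onto the interval `[-c_k, c_k]`. -/
noncomputable def CZero.clamp (x : CZero) (c : ℕ → ℝ) (hc : ∀ k, 0 ≤ c k) : CZero where
  toFun k := max (-(c k)) (min (c k) (x k))
  continuous_toFun := continuous_of_discreteTopology
  zero_at_infty' := by
    rw [Filter.cocompact_eq_cofinite, Nat.cofinite_eq_atTop]
    refine squeeze_zero_norm (fun k => ?_) (by simpa using x.tendsto_atTop.abs)
    have hck := hc k
    rw [Real.norm_eq_abs, abs_le]
    constructor
    · exact le_max_of_le_right (le_min (by linarith [abs_nonneg (x k)]) (neg_abs_le _))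
    · exact max_le (by linarith [abs_nonneg (x k)]) ((min_le_right _ _).trans (le_abs_self _))

theorem CZero.clamp_apply (x : CZero) (c : ℕ → ℝ) (hc : ∀ k, 0 ≤ c k) (k : ℕ) :
    x.clamp c hc k = max (-(c k)) (min (c k) (x k)) := rfl

theorem CZero.clamp_mem_EgammaD (x : CZero) (γ : ℕ → ℝ) (δ : ℝ) :
    x.clamp (fun k => max (γ k - δ) 0) (fun _ => le_max_right _ _) ∈ EgammaD γ δ := by
  intro k
  rw [CZero.clamp_apply, abs_le]
  exact ⟨le_max_left _ _, max_le (by linarith [le_max_right (γ k - δ) 0]) (min_le_left _ _)⟩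

theorem CZero.dist_clamp_le {x : CZero} {γ : ℕ → ℝ} (hx : x ∈ Egamma γ) {δ : ℝ} (hδ : 0 ≤ δ) :
    dist (x.clamp (fun k => max (γ k - δ) 0) (fun _ => le_max_right _ _)) x ≤ δ := by
  refine (CZero.dist_le_iff hδ).2 fun k => ?_
  have hxk := abs_le.1 (hx k)
  have hck := le_max_left (γ k - δ) 0
  rw [CZero.clamp_apply, abs_sub_le_iff]
  constructor
  · rw [sub_le_iff_le_add]
    exact max_le (by linarith) ((min_le_right _ _).trans (by linarith))
  · rw [sub_le_iff_le_add, ← sub_le_iff_le_add']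
    exact le_max_of_le_right (le_min (by linarith) (by linarith))

/-- The largest `ν_k`-mass of an open interval of radius `δ`. -/
noncomputable def maxIntervalMass (γ : ℕ → ℝ) (δ : ℝ) (k : ℕ) : ENNReal :=
  if γ k = 0 then 1 else (ENNReal.ofReal (2 * γ k))⁻¹ * ENNReal.ofReal (2 * min δ (γ k))

theorem nuMeas_Ioo_le (γ : ℕ → ℝ) (δ y : ℝ) (k : ℕ) :
    nuMeas γ k (Set.Ioo (y - δ) (y + δ)) ≤ maxIntervalMass γ δ k := by
  unfold nuMeas maxIntervalMass
  split_ifs with h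
  · exact prob_le_one
  · rw [Measure.smul_apply, smul_eq_mul, Measure.restrict_apply measurableSet_Ioo]
    gcongr
    rcases le_total δ (γ k) with hδ | hδ
    · rw [min_eq_left hδ]
      refine (measure_mono Set.inter_subset_left).trans ?_
      rw [Real.volume_Ioo]
      exact ENNReal.ofReal_le_ofReal (by linarith)
    · rw [min_eq_right hδ]
      refine (measure_mono Set.inter_subset_right).trans ?_
      rw [Real.volume_Icc]
      exact ENNReal.ofReal_le_ofReal (by linarith)

theorem nuMeas_Ioo_eq {γ : ℕ → ℝ} {k : ℕ} {δ w : ℝ} (hδ : 0 < δ)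
    (hw : |w| ≤ max (γ k - δ) 0) :
    nuMeas γ k (Set.Ioo (w - δ) (w + δ)) = maxIntervalMass γ δ k := by
  refine le_antisymm (nuMeas_Ioo_le γ δ w k) ?_
  unfold nuMeas maxIntervalMass
  split_ifs with h
  · rw [h, max_eq_right (by linarith), abs_nonpos_iff] at hw
    rw [Measure.dirac_apply_of_mem (by simp [hw, hδ])]
  · rw [Measure.smul_apply, smul_eq_mul, Measure.restrict_apply measurableSet_Ioo]
    gcongr
    have hsub : Set.Ioo (w - min δ (γ k)) (w + min δ (γ k)) ⊆
        Set.Ioo (w - δ) (w + δ) ∩ Set.Icc (-(γ k)) (γ k) := by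
      rcases le_total δ (γ k) with hδγ | hδγ
      · rw [max_eq_left (by linarith), abs_le] at hw
        rw [min_eq_left hδγ]
        rintro z ⟨hz1, hz2⟩
        exact ⟨⟨hz1, hz2⟩, by linarith, by linarith⟩
      · rw [max_eq_right (by linarith), abs_nonpos_iff] at hw
        rw [min_eq_right hδγ, hw]
        rintro z ⟨hz1, hz2⟩
        exact ⟨⟨by linarith, by linarith⟩, by linarith, by linarith⟩
    refine le_trans (le_of_eq ?_) (measure_mono hsub)
    rw [Real.volume_Ioo]
    congr 1
    ring

theorem maxIntervalMass_ne_zero {γ : ℕ → ℝ} {k : ℕ} (hγ0 : 0 ≤ γ k) {δ : ℝ} (hδ : 0 < δ) :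
    maxIntervalMass γ δ k ≠ 0 := by
  unfold maxIntervalMass
  split_ifs with h
  · exact one_ne_zero
  · have hpos : 0 < γ k := lt_of_le_of_ne hγ0 (Ne.symm h)
    refine mul_ne_zero (ENNReal.inv_ne_zero.2 ENNReal.ofReal_ne_top) ?_
    exact (ENNReal.ofReal_pos.2 (mul_pos two_pos (lt_min hδ hpos))).ne'

theorem maxIntervalMass_eq_one {γ : ℕ → ℝ} {k : ℕ} (hγ0 : 0 ≤ γ k) {δ : ℝ} (hδ : γ k ≤ δ) :
    maxIntervalMass γ δ k = 1 := by
  unfold maxIntervalMass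
  split_ifs with h
  · rfl
  · have hpos : 0 < γ k := lt_of_le_of_ne hγ0 (Ne.symm h)
    rw [min_eq_right hδ]
    exact ENNReal.inv_mul_cancel (ENNReal.ofReal_pos.2 (by linarith)).ne' ENNReal.ofReal_ne_top

section UniformSeriesLaw

variable {γ : ℕ → ℝ} [MeasurableSpace CZero] [BorelSpace CZero] {μ : Measure CZero}
  [IsProbabilityMeasure μ]

theorem IsUniformSeriesLaw.tendsto_prod_measure_ball (hμ : IsUniformSeriesLaw γ μ) (y : CZero)
    {δ : ℝ} (hδ : 0 < δ) :
    Tendsto (fun n => ∏ k ∈ Finset.range n, nuMeas γ k (Set.Ioo (y k - δ) (y k + δ))) atTop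
      (𝓝 (μ (ball y δ))) := by
  rw [CZero.ball_eq_iInter y hδ]
  have h := tendsto_measure_iInter_atTop (μ := μ)
    (s := fun n : ℕ => {x : CZero | ∀ k < n, x k ∈ Set.Ioo (y k - δ) (y k + δ)})
    (fun n => by
      refine MeasurableSet.nullMeasurableSet ?_
      simp only [Set.ofPred_forall]
      exact .iInter fun k => .iInter fun _ => CZero.measurable_apply k measurableSet_Ioo)
    (fun m n hmn x hx k hk => hx k (hk.trans_le hmn)) ⟨0, measure_ne_top _ _⟩
  refine h.congr fun n => ?_
  exact hμ n (fun k => Set.Ioo (y k - δ) (y k + δ)) fun _ => measurableSet_Ioo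

theorem IsUniformSeriesLaw.tendsto_prod_maxIntervalMass (hμ : IsUniformSeriesLaw γ μ)
    {δ : ℝ} (hδ : 0 < δ) {w : CZero} (hw : w ∈ EgammaD γ δ) :
    Tendsto (fun n => ∏ k ∈ Finset.range n, maxIntervalMass γ δ k) atTop
      (𝓝 (μ (ball w δ))) :=
  (hμ.tendsto_prod_measure_ball w hδ).congr fun _ =>
    Finset.prod_congr rfl fun k _ => nuMeas_Ioo_eq hδ (hw k)

theorem IsUniformSeriesLaw.maxBallProb_eq (hμ : IsUniformSeriesLaw γ μ)
    {δ : ℝ} (hδ : 0 < δ) {w : CZero} (hw : w ∈ EgammaD γ δ) :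
    maxBallProb μ δ = (μ (ball w δ)).toReal := by
  have hle : ∀ y : CZero, (μ (ball y δ)).toReal ≤ (μ (ball w δ)).toReal := fun y =>
    ENNReal.toReal_mono (measure_ne_top _ _) <|
      le_of_tendsto_of_tendsto' (hμ.tendsto_prod_measure_ball y hδ)
        (hμ.tendsto_prod_maxIntervalMass hδ hw) fun n =>
          Finset.prod_le_prod' fun k _ => nuMeas_Ioo_le γ δ (y k) k
  exact le_antisymm (ciSup_le hle)
    (le_ciSup (f := fun y : CZero => (μ (ball y δ)).toReal) ⟨_, Set.forall_mem_range.2 hle⟩ w)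

theorem IsUniformSeriesLaw.measure_ball_ne_zero (hμ : IsUniformSeriesLaw γ μ)
    (hγ0 : ∀ k, 0 ≤ γ k) (hγ : Tendsto γ atTop (𝓝 0)) {δ : ℝ} (hδ : 0 < δ) {w : CZero}
    (hw : w ∈ EgammaD γ δ) : μ (ball w δ) ≠ 0 := by
  obtain ⟨N, hN⟩ := eventually_atTop.1 (hγ.eventually (gt_mem_nhds hδ))
  have hconst : ∀ n ≥ N, ∏ k ∈ Finset.range n, maxIntervalMass γ δ k =
      ∏ k ∈ Finset.range N, maxIntervalMass γ δ k := fun n hn =>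
    (Finset.prod_subset (Finset.range_mono hn) fun k _ hk =>
      maxIntervalMass_eq_one (hγ0 k) (hN k (by simpa using hk)).le).symm
  rw [tendsto_nhds_unique (hμ.tendsto_prod_maxIntervalMass hδ hw)
    (tendsto_atTop_of_eventually_const hconst)]
  exact Finset.prod_ne_zero_iff.2 fun k _ => maxIntervalMass_ne_zero (hγ0 k) hδ

theorem IsUniformSeriesLaw.measure_ball_eq_zero (hμ : IsUniformSeriesLaw γ μ) {y : CZero} {k : ℕ}
    {δ : ℝ} (hδ : 0 < δ) (hy : γ k + δ < |y k|) : μ (ball y δ) = 0 := by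
  have hnu : nuMeas γ k (Set.Ioo (y k - δ) (y k + δ)) = 0 := by
    have hdisj : Disjoint (Set.Ioo (y k - δ) (y k + δ)) (Set.Icc (-(γ k)) (γ k)) := by
      rw [Set.disjoint_left]
      rintro z ⟨hz1, hz2⟩ ⟨hz3, hz4⟩
      rcases lt_abs.1 hy with h | h <;> linarith
    unfold nuMeas
    split_ifs with h
    · rw [Measure.dirac_apply' _ measurableSet_Ioo]
      exact Set.indicator_of_notMem (Set.disjoint_right.1 hdisj (by simp [h])) _
    · rw [Measure.smul_apply, Measure.restrict_apply measurableSet_Ioo, hdisj.inter_eq]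
      simp
  refine tendsto_nhds_unique (hμ.tendsto_prod_measure_ball y hδ)
    (tendsto_atTop_of_eventually_const (i₀ := k + 1) fun n hn => ?_)
  exact Finset.prod_eq_zero (Finset.mem_range.2 hn) hnu

end UniformSeriesLaw

theorem generalizedMode_iff_mem_Egamma (γ : ℕ → ℝ) (hγ0 : ∀ k, 0 ≤ γ k)
    (hγ : Tendsto γ atTop (𝓝 (0 : ℝ)))
    [MeasurableSpace CZero] [BorelSpace CZero]
    (μ : Measure CZero) [IsProbabilityMeasure μ] (hμ : IsUniformSeriesLaw γ μ)
    (x : CZero) :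
    IsGeneralizedMode μ x ↔ x ∈ Egamma γ := by
  constructor
  · intro hmode k
    by_contra! hk
    obtain ⟨w, hw, hratio⟩ := hmode (fun n : ℕ => 1 / ((n : ℝ) + 1))
      (fun n => Nat.one_div_pos_of_nat) tendsto_one_div_add_atTop_nhds_zero_nat
    have hsum : Tendsto (fun n : ℕ => γ k + 2 * (1 / ((n : ℝ) + 1) + dist (w n) x)) atTop
        (𝓝 (γ k)) := by
      simpa using ((tendsto_one_div_add_atTop_nhds_zero_nat (𝕜 := ℝ)).add
        (tendsto_iff_dist_tendsto_zero.1 hw)).const_mul 2 |>.const_add (γ k)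
    refine one_ne_zero (tendsto_nhds_unique hratio (tendsto_const_nhds.congr' ?_))
    filter_upwards [hsum.eventually (gt_mem_nhds hk)] with n hn
    have hδ : 0 < 1 / ((n : ℝ) + 1) := Nat.one_div_pos_of_nat
    have hwk := CZero.abs_sub_le_dist (w n) x k
    have htri := abs_sub_abs_le_abs_sub (x k) (w n k)
    rw [abs_sub_comm] at htri
    have hd : 0 ≤ dist (w n) x := dist_nonneg
    rw [hμ.measure_ball_eq_zero (k := k) hδ (by linarith)]
    simp
  · intro hx δ hδ hδ0
    refine ⟨fun n => x.clamp (fun k => max (γ k - δ n) 0) (fun _ => le_max_right _ _), ?_, ?_⟩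
    · exact tendsto_iff_dist_tendsto_zero.2
        (squeeze_zero (fun _ => dist_nonneg) (fun n => CZero.dist_clamp_le hx (hδ n).le) hδ0)
    · refine tendsto_const_nhds.congr fun n => ?_
      have hmem := x.clamp_mem_EgammaD γ (δ n)
      rw [hμ.maxBallProb_eq (hδ n) hmem, div_self]
      exact ENNReal.toReal_ne_zero.2
        ⟨hμ.measure_ball_ne_zero hγ0 hγ (hδ n) hmem, measure_ne_top _ _⟩
end
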